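/- For every integer n ≥ 3 and every real c > 0, the function x ↦ ω(x) − x·ω'(x) tends to 2(2n−1)·c/(n−1) as x → ∞; in particular, ω(x) − x·ω'(x) is bounded on [x₀,∞). -/

import Mathlib

open Real Filter

noncomputable def alphaF (n : ℕ) (c : ℝ) (x : ℝ) : ℝ :=
  (n : ℝ) * c + ((n : ℝ) / (2 * ((n : ℝ) - 1))) * x
    - (((n : ℝ) - 2) / (2 * ((n : ℝ) - 1))) * Real.sqrt (x ^ 2 + 4 * ((n : ℝ) - 1) * c * x)

noncomputable def yn (n : ℕ) : ℝ :=
  4 * (1 - (n : ℝ)) + (2 * ((n : ℝ) ^ 2 - 4) / Real.sqrt (2 * (n : ℝ) - 5)) *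
    Real.cos ((1 / 3) * Real.arctan (((n : ℝ) ^ 2 - 4 * (n : ℝ) + 6) /
      (2 * ((n : ℝ) - 1) * Real.sqrt (2 * (n : ℝ) - 5))))

noncomputable def x0 (n : ℕ) (c : ℝ) : ℝ := yn n * c

noncomputable def betaF (n : ℕ) (c : ℝ) (x : ℝ) : ℝ :=
  alphaF n c (x0 n c) + deriv (alphaF n c) (x0 n c) * (x - x0 n c)
    + (1 / 2) * deriv (deriv (alphaF n c)) (x0 n c) * (x - x0 n c) ^ 2

noncomputable def gammaF (n : ℕ) (c : ℝ) (x : ℝ) : ℝ :=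
  if x0 n c ≤ x then alphaF n c x else betaF n c x

noncomputable def gammaF' (n : ℕ) (c : ℝ) (x : ℝ) : ℝ :=
  derivWithin (gammaF n c) (Set.Ici 0) x

noncomputable def gammaF'' (n : ℕ) (c : ℝ) (x : ℝ) : ℝ :=
  derivWithin (gammaF' n c) (Set.Ici 0) x

noncomputable def omegaF (n : ℕ) (c : ℝ) (x : ℝ) : ℝ :=
  (x ^ 2 / Real.sqrt (x ^ 2 + 4 * ((n : ℝ) - 1) * c * x)) *
    ((1 + (n : ℝ) ^ 2 * c / x) *
      (((n : ℝ) / ((n : ℝ) - 2) - (1 + 4 * ((n : ℝ) - 1) * c / x) ^ (-(1 / 2) : ℝ)) /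
       ((n : ℝ) / ((n : ℝ) - 2) + (1 + 4 * ((n : ℝ) - 1) * c / x) ^ (-(1 / 2) : ℝ)))) ^ 2

/-- The profile of `omegaF` in the variable `s = c / x`: one has `omegaF n c x = x * omegaProfile n (c / x)`
for `x > 0`. -/
noncomputable def omegaProfile (m s : ℝ) : ℝ :=
  (1 + 4 * (m - 1) * s) ^ (-(1 / 2) : ℝ) *
    ((1 + m ^ 2 * s) *
      ((m / (m - 2) - (1 + 4 * (m - 1) * s) ^ (-(1 / 2) : ℝ)) /
       (m / (m - 2) + (1 + 4 * (m - 1) * s) ^ (-(1 / 2) : ℝ)))) ^ 2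

theorem omegaF_eq_mul_omegaProfile {n : ℕ} (hn : 3 ≤ n) {c x : ℝ} (hc : 0 < c) (hx : 0 < x) :
    omegaF n c x = x * omegaProfile n (c / x) := by
  have hm : (3 : ℝ) ≤ n := by exact_mod_cast hn
  have hu : 0 < 1 + 4 * ((n : ℝ) - 1) * (c / x) := by
    have : 0 < ((n : ℝ) - 1) * (c / x) := mul_pos (by linarith) (div_pos hc hx)
    linarith
  have hsqrt : √(x ^ 2 + 4 * ((n : ℝ) - 1) * c * x) = x * √(1 + 4 * ((n : ℝ) - 1) * (c / x)) := by
    have h : x ^ 2 + 4 * ((n : ℝ) - 1) * c * x = x ^ 2 * (1 + 4 * ((n : ℝ) - 1) * (c / x)) := by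
      field_simp
    rw [h, Real.sqrt_mul (sq_nonneg x), Real.sqrt_sq hx.le]
  have hfactor : x ^ 2 / √(x ^ 2 + 4 * ((n : ℝ) - 1) * c * x)
      = x * (1 + 4 * ((n : ℝ) - 1) * (c / x)) ^ (-(1 / 2) : ℝ) := by
    rw [hsqrt, Real.rpow_neg hu.le, ← Real.sqrt_eq_rpow]
    have := Real.sqrt_pos.2 hu
    field_simp
  rw [omegaF, omegaProfile, hfactor, mul_div_assoc, mul_div_assoc, mul_assoc]

theorem contDiffOn_omegaProfile {m : ℝ} (hm : 2 < m) :
    ContDiffOn ℝ 1 (omegaProfile m) {s | 0 < 1 + 4 * (m - 1) * s} := by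
  have hv : ContDiffOn ℝ 1 (fun s : ℝ => (1 + 4 * (m - 1) * s) ^ (-(1 / 2) : ℝ))
      {s | 0 < 1 + 4 * (m - 1) * s} :=
    ContDiffOn.rpow_const_of_ne (by fun_prop) fun s hs => ne_of_gt hs
  refine hv.mul (ContDiffOn.pow (ContDiffOn.mul (by fun_prop)
    ((contDiffOn_const.sub hv).div (contDiffOn_const.add hv) fun s hs => ?_)) 2)
  have h₁ : 0 < m / (m - 2) := div_pos (by linarith) (by linarith)
  have h₂ := Real.rpow_pos_of_pos hs (-(1 / 2) : ℝ)
  positivity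

theorem isOpen_omegaProfile_domain (m : ℝ) : IsOpen {s : ℝ | 0 < 1 + 4 * (m - 1) * s} :=
  isOpen_lt continuous_const (by fun_prop)

theorem continuousOn_deriv_omegaProfile {m : ℝ} (hm : 2 < m) :
    ContinuousOn (deriv (omegaProfile m)) {s | 0 < 1 + 4 * (m - 1) * s} :=
  (contDiffOn_omegaProfile hm).continuousOn_deriv_of_isOpen (isOpen_omegaProfile_domain m) le_rfl

theorem mem_omegaProfile_domain {m s : ℝ} (hm : 1 < m) (hs : 0 ≤ s) :
    s ∈ {s : ℝ | 0 < 1 + 4 * (m - 1) * s} := by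
  have : 0 ≤ (m - 1) * s := mul_nonneg (by linarith) hs
  show 0 < 1 + 4 * (m - 1) * s
  linarith

theorem deriv_omegaProfile_zero {m : ℝ} (hm : 2 < m) :
    deriv (omegaProfile m) 0 = 2 * (2 * m - 1) / (m - 1) := by
  have h₁ : m - 1 ≠ 0 := by linarith
  have h₂ : m - 2 ≠ 0 := by linarith
  have hlin (k : ℝ) : HasDerivAt (fun s : ℝ => 1 + k * s) k 0 := by
    simpa using ((hasDerivAt_id (0 : ℝ)).const_mul k).const_add 1
  have hv : HasDerivAt (fun s : ℝ => (1 + 4 * (m - 1) * s) ^ (-(1 / 2) : ℝ)) (-2 * (m - 1)) 0 := by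
    convert (hlin (4 * (m - 1))).rpow_const (p := -(1 / 2)) (Or.inl (by simp)) using 1
    simp
    ring
  have hden : m / (m - 2) + 1 ≠ 0 := by
    have : 0 < m / (m - 2) := div_pos (by linarith) (by linarith)
    positivity
  have h := hv.mul (((hlin (m ^ 2)).mul ((hv.const_sub (m / (m - 2))).div
    (hv.const_add (m / (m - 2))) (by simpa using hden))).pow 2)
  refine (HasDerivAt.deriv h).trans ?_
  have hsum : m / (m - 2) + 1 = 2 * (m - 1) / (m - 2) := by field_simp; ring
  have hsub : m / (m - 2) - 1 = 2 / (m - 2) := by field_simp; ring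
  simp [hsum, hsub]
  field_simp
  ring

theorem omegaF_sub_mul_deriv {n : ℕ} (hn : 3 ≤ n) {c x : ℝ} (hc : 0 < c) (hx : 0 < x) :
    omegaF n c x - x * deriv (omegaF n c) x = c * deriv (omegaProfile n) (c / x) := by
  have hm : (3 : ℝ) ≤ n := by exact_mod_cast hn
  have hF : HasDerivAt (omegaProfile n) (deriv (omegaProfile n) (c / x)) (c / x) :=
    (((contDiffOn_omegaProfile (by linarith)).contDiffAt
      ((isOpen_omegaProfile_domain n).mem_nhds
        (mem_omegaProfile_domain (by linarith) (div_pos hc hx).le))).differentiableAt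
          one_ne_zero).hasDerivAt
  have hs : HasDerivAt (fun y : ℝ => c / y) (-c / x ^ 2) x := by
    simpa [div_eq_mul_inv] using (hasDerivAt_inv hx.ne').const_mul c
  have h := (hasDerivAt_id x).mul (hF.comp x hs)
  have heq : omegaF n c =ᶠ[nhds x] id * (omegaProfile n ∘ fun y => c / y) := by
    filter_upwards [lt_mem_nhds hx] with y hy
    exact omegaF_eq_mul_omegaProfile hn hc hy
  rw [heq.deriv_eq, h.deriv, omegaF_eq_mul_omegaProfile hn hc hx]
  simp only [Function.comp_apply, id_eq]
  field_simp
  ring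

theorem yn_pos {n : ℕ} (hn : 3 ≤ n) : 0 < yn n := by
  have hm : (3 : ℝ) ≤ n := by exact_mod_cast hn
  rw [yn]
  set m : ℝ := (n : ℝ)
  set r := √(2 * m - 5)
  have hr : 0 < r := Real.sqrt_pos.2 (by linarith)
  have hr2 : r ^ 2 = 2 * m - 5 := Real.sq_sqrt (by linarith)
  set t := (m ^ 2 - 4 * m + 6) / (2 * (m - 1) * r)
  have ht : 0 < t := div_pos (by nlinarith) (mul_pos (by linarith) hr)
  have hθ : 0 < Real.arctan t := Real.arctan_pos.2 ht
  have hcos : √3 / 2 < Real.cos (1 / 3 * Real.arctan t) := by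
    rw [← Real.cos_pi_div_six]
    have := Real.arctan_lt_pi_div_two t
    exact Real.cos_lt_cos_of_nonneg_of_le_pi_div_two (by positivity)
      (by linarith [Real.pi_pos]) (by linarith)
  have hpoly : 4 * (m - 1) * r ≤ √3 * (m ^ 2 - 4) := by
    refine abs_le_of_sq_le_sq' ?_ ?_ |>.2
    · have h3 : √3 ^ 2 = (3 : ℝ) := Real.sq_sqrt (by norm_num)
      rw [mul_pow, mul_pow, mul_pow, hr2, h3]
      nlinarith [mul_nonneg (sq_nonneg (m - 4)) (show 0 ≤ 3 * m ^ 2 - 8 * m + 8 by nlinarith)]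
    · exact mul_nonneg (Real.sqrt_nonneg 3) (by nlinarith)
  have hcoef : 0 < 2 * (m ^ 2 - 4) / r := div_pos (by nlinarith) hr
  have hbase : 4 * (m - 1) ≤ 2 * (m ^ 2 - 4) / r * (√3 / 2) := by
    rw [div_mul_eq_mul_div, le_div_iff₀ hr]
    linarith
  linarith [mul_lt_mul_of_pos_left hcos hcoef]

theorem stmt_15 (n : ℕ) (hn : 3 ≤ n) (c : ℝ) (hc : 0 < c) :
    Filter.Tendsto (fun x => omegaF n c x - x * deriv (omegaF n c) x)
      Filter.atTop (nhds (2 * (2 * (n : ℝ) - 1) * c / ((n : ℝ) - 1))) ∧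
    ∃ M : ℝ, ∀ x : ℝ, x0 n c ≤ x → |omegaF n c x - x * deriv (omegaF n c) x| ≤ M := by
  have hm : (3 : ℝ) ≤ n := by exact_mod_cast hn
  have hcont := continuousOn_deriv_omegaProfile (m := n) (by linarith)
  constructor
  · have h0 : ContinuousAt (deriv (omegaProfile n)) 0 :=
      hcont.continuousAt ((isOpen_omegaProfile_domain n).mem_nhds
        (mem_omegaProfile_domain (by linarith) le_rfl))
    have h := (h0.tendsto.comp (tendsto_const_nhds.div_atTop tendsto_id :
      Tendsto (fun x : ℝ => c / x) atTop (nhds 0))).const_mul c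
    rw [deriv_omegaProfile_zero (by linarith), ← mul_div_assoc, mul_comm c] at h
    refine h.congr' ?_
    filter_upwards [eventually_gt_atTop 0] with x hx
    exact (omegaF_sub_mul_deriv hn hc hx).symm
  · have hx0 : 0 < x0 n c := mul_pos (yn_pos hn) hc
    obtain ⟨M, hM⟩ := (isCompact_Icc (a := (0 : ℝ)) (b := c / x0 n c)).exists_bound_of_continuousOn
      (hcont.mono fun s hs => mem_omegaProfile_domain (by linarith) hs.1)
    refine ⟨c * M, fun x hx => ?_⟩
    have hxpos := hx0.trans_le hx
    rw [omegaF_sub_mul_deriv hn hc hxpos, abs_mul, abs_of_pos hc]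
    exact mul_le_mul_of_nonneg_left
      (hM _ ⟨(div_pos hc hxpos).le, div_le_div_of_nonneg_left hc.le hx0 hx⟩) hc.le
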